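/- Let G₀ = ℤ/2 ⋆ ℤ/3 with canonical generators a (of order 2) and b (of order 3). Then the subgroup H of G₀ generated by {a, b⁻¹ab²} has index 3 in G₀, and the homomorphism ℤ/2 ⋆ ℤ → G₀ sending the canonical generator of the ℤ/2 factor to a and the generator of the ℤ factor to b⁻¹ab² is injective with range equal to H. -/

import Mathlib

/-- The free product ℤ/2 ⋆ ℤ/3. -/
abbrev G₀ : Type :=
  Monoid.Coprod (Multiplicative (ZMod 2)) (Multiplicative (ZMod 3))

/-- The canonical generator `a` of the first factor (of order 2). -/
def genA : G₀ := Monoid.Coprod.inl (Multiplicative.ofAdd 1)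

/-- The canonical generator `b` of the second factor (of order 3). -/
def genB : G₀ := Monoid.Coprod.inr (Multiplicative.ofAdd 1)

open Monoid

/-- The free product ℤ/2 ⋆ ℤ. -/
abbrev ZTwoStarZ : Type :=
  Coprod (Multiplicative (ZMod 2)) (Multiplicative ℤ)

lemma zmodTwo_cases (x : Multiplicative (ZMod 2)) : x = 1 ∨ x = Multiplicative.ofAdd 1 := by
  revert x
  decide

/-- The homomorphism from ℤ/2 sending the generator to an element squaring to `1`. -/
def involutionHom {G : Type*} [Group G] (g : G) (hg : g * g = 1) :
    Multiplicative (ZMod 2) →* G where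
  toFun x := if x = 1 then 1 else g
  map_one' := if_pos rfl
  map_mul' x y := by
    have hsq : (Multiplicative.ofAdd 1 * Multiplicative.ofAdd 1 : Multiplicative (ZMod 2)) = 1 := by
      decide
    rcases zmodTwo_cases x with rfl | rfl <;> rcases zmodTwo_cases y with rfl | rfl <;>
      simp [hsq, hg]

lemma involutionHom_ofAdd_one {G : Type*} [Group G] (g : G) (hg : g * g = 1) :
    involutionHom g hg (Multiplicative.ofAdd 1) = g := by
  simp [involutionHom]

lemma genA_mul_genA : genA * genA = 1 := by
  rw [genA, ← map_mul, ← map_one Coprod.inl]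
  exact congrArg _ (by decide)

lemma genB_pow (n : ℕ) : genB ^ n = Coprod.inr (Multiplicative.ofAdd (n : ZMod 3)) := by
  rw [genB, ← map_pow, ← ofAdd_nsmul, nsmul_one]

lemma genB_inv : genB⁻¹ = Coprod.inr (Multiplicative.ofAdd (2 : ZMod 3)) := by
  rw [genB, ← map_inv]
  exact congrArg _ (by decide)

/-- The element `b⁻¹ab²` of ℤ/2 ⋆ ℤ/3. -/
def genC : G₀ := genB⁻¹ * genA * genB ^ 2

/-- The homomorphism ℤ/2 ⋆ ℤ → ℤ/2 ⋆ ℤ/3 sending the generators to `a` and `b⁻¹ab²`. -/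
def embedHom : ZTwoStarZ →* G₀ :=
  Coprod.lift (involutionHom genA genA_mul_genA) (zpowersHom G₀ genC)

/-- The generator of the factor ℤ/2 of ℤ/2 ⋆ ℤ. -/
def genS : ZTwoStarZ := Coprod.inl (Multiplicative.ofAdd 1)

/-- The generator of the factor ℤ of ℤ/2 ⋆ ℤ. -/
def genT : ZTwoStarZ := Coprod.inr (Multiplicative.ofAdd 1)

lemma genS_mul_genS : genS * genS = 1 := by
  rw [genS, ← map_mul, ← map_one Coprod.inl]
  exact congrArg _ (by decide)

lemma inr_eq_genT_zpow (n : Multiplicative ℤ) :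
    (Coprod.inr n : ZTwoStarZ) = genT ^ n.toAdd := by
  rw [genT, ← map_zpow, ← ofAdd_zsmul, smul_eq_mul, mul_one, ofAdd_toAdd]

lemma embedHom_genS : embedHom genS = genA := by
  rw [embedHom, genS, Coprod.lift_apply_inl, involutionHom_ofAdd_one]

lemma embedHom_genT : embedHom genT = genC := by
  simp [embedHom, genT]

/-- How `a` permutes the decompositions `bⁱ φ(k)` of elements of ℤ/2 ⋆ ℤ/3, where `φ` is
`embedHom`. -/
def actAFun (x : ZMod 3 × ZTwoStarZ) : ZMod 3 × ZTwoStarZ :=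
  if x.1 = 0 then (0, genS * x.2) else if x.1 = 1 then (2, genT⁻¹ * x.2) else (1, genT * x.2)

lemma actAFun_zero (k : ZTwoStarZ) : actAFun (0, k) = (0, genS * k) := rfl

lemma actAFun_one (k : ZTwoStarZ) : actAFun (1, k) = (2, genT⁻¹ * k) := rfl

lemma actAFun_two (k : ZTwoStarZ) : actAFun (2, k) = (1, genT * k) := rfl

lemma zmodThree_cases (i : ZMod 3) : i = 0 ∨ i = 1 ∨ i = 2 := by
  revert i
  decide

lemma actAFun_involutive : Function.Involutive actAFun := by
  rintro ⟨i, k⟩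
  rcases zmodThree_cases i with rfl | rfl | rfl <;>
    simp [actAFun_zero, actAFun_one, actAFun_two, ← mul_assoc, genS_mul_genS]

/-- The action of ℤ/3 on the decompositions `bⁱ φ(k)`. -/
def actB : Multiplicative (ZMod 3) →* Equiv.Perm (ZMod 3 × ZTwoStarZ) where
  toFun j := (Equiv.addLeft j.toAdd).prodCongr (Equiv.refl _)
  map_one' := by ext x <;> simp
  map_mul' i j := by ext x <;> simp [add_assoc]

lemma actB_apply (j : Multiplicative (ZMod 3)) (i : ZMod 3) (k : ZTwoStarZ) :
    actB j (i, k) = (j.toAdd + i, k) := rfl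

/-- The action of ℤ/2 ⋆ ℤ/3 on the decompositions `bⁱ φ(k)`. -/
def cosetAction : G₀ →* Equiv.Perm (ZMod 3 × ZTwoStarZ) :=
  Coprod.lift
    (involutionHom actAFun_involutive.toPerm (Equiv.ext actAFun_involutive)) actB

lemma cosetAction_genA (x : ZMod 3 × ZTwoStarZ) : cosetAction genA x = actAFun x := by
  rw [cosetAction, genA, Coprod.lift_apply_inl, involutionHom_ofAdd_one]
  rfl

lemma cosetAction_inr (j : Multiplicative (ZMod 3)) (i : ZMod 3) (k : ZTwoStarZ) :
    cosetAction (Coprod.inr j) (i, k) = (j.toAdd + i, k) := by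
  rw [cosetAction, Coprod.lift_apply_inr, actB_apply]

lemma cosetAction_genC (k : ZTwoStarZ) : cosetAction genC (0, k) = (0, genT * k) := by
  have h : (2 + 1 : ZMod 3) = 0 := by decide
  simp [genC, genB_inv, genB_pow, cosetAction_inr, cosetAction_genA, actAFun_two, h]

lemma cosetAction_genC_zpow (n : ℤ) (k : ZTwoStarZ) :
    cosetAction (genC ^ n) (0, k) = (0, genT ^ n * k) := by
  induction n generalizing k with
  | zero => simp
  | succ n ih =>
    rw [zpow_add_one, zpow_add_one, map_mul, Equiv.Perm.mul_apply, cosetAction_genC, ih, mul_assoc]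
  | pred n ih =>
    rw [zpow_sub_one, zpow_sub_one, map_mul, Equiv.Perm.mul_apply, mul_assoc, ← ih, map_inv]
    congr 1
    rw [Equiv.Perm.inv_eq_iff_eq, cosetAction_genC, mul_inv_cancel_left]

lemma cosetAction_embedHom (k l : ZTwoStarZ) :
    cosetAction (embedHom k) (0, l) = (0, k * l) := by
  induction k using Coprod.induction_on generalizing l with
  | inl x =>
    rcases zmodTwo_cases x with rfl | rfl
    · simp
    · rw [← genS, embedHom_genS, cosetAction_genA, actAFun_zero]
  | inr n => rw [inr_eq_genT_zpow, map_zpow, embedHom_genT, cosetAction_genC_zpow]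
  | mul x y hx hy => rw [map_mul, map_mul, Equiv.Perm.mul_apply, hy, hx, mul_assoc]

lemma embedHom_injective : Function.Injective embedHom := by
  intro k l h
  have := cosetAction_embedHom k 1
  rw [h, cosetAction_embedHom] at this
  simpa using (congrArg Prod.snd this).symm

/-- The element `bⁱ φ(k)` with `φ = embedHom`. -/
def recompose (x : ZMod 3 × ZTwoStarZ) : G₀ :=
  Coprod.inr (Multiplicative.ofAdd x.1) * embedHom x.2

lemma recompose_actAFun (x : ZMod 3 × ZTwoStarZ) :
    recompose (actAFun x) = genA * recompose x := by
  have hA : genA⁻¹ = genA := inv_eq_of_mul_eq_one_left genA_mul_genA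
  have hB₁ : (Coprod.inr (Multiplicative.ofAdd (1 : ZMod 3)) : G₀) = genB := rfl
  have hB₂ : (Coprod.inr (Multiplicative.ofAdd (2 : ZMod 3)) : G₀) = genB ^ 2 :=
    (genB_pow 2).symm
  have hinv : genB⁻¹ = genB ^ 2 := by rw [genB_inv, hB₂]
  obtain ⟨i, k⟩ := x
  rcases zmodThree_cases i with rfl | rfl | rfl
  · simp [recompose, actAFun_zero, embedHom_genS]
  · rw [actAFun_one]
    simp only [recompose, hB₁, hB₂, map_mul, map_inv, embedHom_genT, genC]
    rw [← hinv]
    simp [mul_assoc, hA]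
  · rw [actAFun_two]
    simp only [recompose, hB₁, hB₂, map_mul, embedHom_genT, genC]
    simp [mul_assoc]

lemma recompose_cosetAction (g : G₀) (x : ZMod 3 × ZTwoStarZ) :
    recompose (cosetAction g x) = g * recompose x := by
  induction g using Coprod.induction_on generalizing x with
  | inl y =>
    rcases zmodTwo_cases y with rfl | rfl
    · simp
    · rw [← genA, cosetAction_genA, recompose_actAFun]
  | inr j =>
    obtain ⟨i, k⟩ := x
    simp [recompose, cosetAction_inr, mul_assoc]
  | mul g h hg hh => rw [map_mul, Equiv.Perm.mul_apply, hg, hh, mul_assoc]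

lemma exists_recompose_eq (g : G₀) : ∃ x, recompose x = g :=
  ⟨cosetAction g (0, 1), by rw [recompose_cosetAction]; simp [recompose]⟩

lemma recompose_injective : Function.Injective recompose := by
  have h (x : ZMod 3 × ZTwoStarZ) : cosetAction (recompose x) (0, 1) = x := by
    simp [recompose, cosetAction_embedHom, cosetAction_inr]
  exact Function.LeftInverse.injective (g := fun g ↦ cosetAction g (0, 1)) h

lemma index_range_embedHom : embedHom.range.index = 3 := by
  let f : ZMod 3 → G₀ ⧸ embedHom.range := fun i ↦
    QuotientGroup.mk (Coprod.inr (Multiplicative.ofAdd i))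
  have hf : Function.Bijective f := by
    constructor
    · intro i j h
      obtain ⟨k, hk⟩ := QuotientGroup.eq.1 h
      have : recompose (i, k) = recompose (j, 1) := by simp [recompose, hk]
      exact congrArg Prod.fst (recompose_injective this)
    · intro q
      obtain ⟨g, rfl⟩ := QuotientGroup.mk_surjective q
      obtain ⟨⟨i, k⟩, rfl⟩ := exists_recompose_eq g
      exact ⟨i, QuotientGroup.eq.2 ⟨k, by simp [recompose]⟩⟩
  rw [Subgroup.index, ← Nat.card_eq_of_bijective f hf, Nat.card_zmod]

lemma range_embedHom : embedHom.range = Subgroup.closure {genA, genC} := by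
  apply le_antisymm
  · rintro _ ⟨k, rfl⟩
    have hA : genA ∈ Subgroup.closure {genA, genC} := Subgroup.subset_closure (by simp)
    have hC : genC ∈ Subgroup.closure {genA, genC} := Subgroup.subset_closure (by simp)
    induction k using Coprod.induction_on with
    | inl x =>
      rcases zmodTwo_cases x with rfl | rfl
      · simp
      · rwa [← genS, embedHom_genS]
    | inr n =>
      rw [inr_eq_genT_zpow, map_zpow, embedHom_genT]
      exact zpow_mem hC _
    | mul x y hx hy =>
      rw [map_mul]
      exact mul_mem hx hy
  · rw [Subgroup.closure_le]
    rintro _ (rfl | rfl)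
    exacts [⟨genS, embedHom_genS⟩, ⟨genT, embedHom_genT⟩]

theorem stmt_16 (a b : G₀) (ha : a = genA) (hb : b = genB)
    (H : Subgroup G₀) (hH : H = Subgroup.closure {a, b⁻¹ * a * b ^ 2}) :
    H.index = 3 ∧
    ∃ φ : Monoid.Coprod (Multiplicative (ZMod 2)) (Multiplicative ℤ) →* G₀,
      φ (Monoid.Coprod.inl (Multiplicative.ofAdd 1)) = a ∧
      φ (Monoid.Coprod.inr (Multiplicative.ofAdd 1)) = b⁻¹ * a * b ^ 2 ∧
      Function.Injective φ ∧ φ.range = H := by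
  subst ha hb
  have hrange : embedHom.range = H := range_embedHom.trans hH.symm
  exact ⟨hrange ▸ index_range_embedHom,
    embedHom, embedHom_genS, embedHom_genT, embedHom_injective, hrange⟩
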